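/- arXiv:1407.2629 — 2 statements merged into one kernel-verified Lean document; each statement's English description precedes it below -/
import Mathlib

section
/- Let M be a sharp toric monoid and N a face of M. Then the following conditions are equivalent: (a) N splits off, i.e. there exists a face K of M such that the addition map N × K → M is bijective; (b) the ideal (N⁺) = N⁺ + M generated by N⁺ = N ∖ {0} is a prime ideal of M and height((N⁺)) ≥ rk(N); (c) the ideal (N⁺) is prime and the face K = M ∖ (N⁺) satisfies rk(K) + rk(N) ≤ rk(M). -/
open scoped TensorProduct Pointwise

/-- The rank of an abelian group `A`, i.e. `dim_ℚ (A ⊗_ℤ ℚ)`, for a subgroup of an ambient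
abelian group. -/
noncomputable def grpRank {G : Type*} [AddCommGroup G] (A : AddSubgroup G) : ℕ :=
  Module.finrank ℚ (ℚ ⊗[ℤ] A)

variable {Λ : Type*} [AddCommGroup Λ]

/-- The rank of the subgroup generated by a subset `S` of `Λ`. -/
noncomputable def setRank (S : Set Λ) : ℕ :=
  grpRank (AddSubgroup.closure S)

/-- The rank of a submonoid `M` of `Λ`; when `Λ = M^gp` this is `rk M = dim_ℚ(M^gp ⊗ ℚ)`. -/
noncomputable def monRank (M : AddSubmonoid Λ) : ℕ :=
  setRank (M : Set Λ)

/-- A toric monoid, presented as a submonoid `M` of an abelian group `Λ` which plays the role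
of `M^gp`: `M` is finitely generated (hence fine, being cancellative as a submonoid of a
group), `M` generates `Λ` as a group (so that `Λ = M^gp`), `Λ` is torsion free, and `M`
is saturated in `Λ`. -/
def IsToric (M : AddSubmonoid Λ) : Prop :=
  M.FG ∧ AddSubgroup.closure (M : Set Λ) = ⊤ ∧
    (∀ (x : Λ) (n : ℕ), 0 < n → n • x = 0 → x = 0) ∧
    (∀ (x : Λ) (n : ℕ), 0 < n → n • x ∈ M → x ∈ M)

/-- `M` is sharp: `0` is its only unit. -/
def IsSharp (M : AddSubmonoid Λ) : Prop :=
  ∀ x ∈ M, ∀ y ∈ M, x + y = 0 → x = 0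

/-- An ideal of the monoid `M`: a subset `I ⊆ M` with `I + M ⊆ I`. -/
def IsMonIdeal (M : AddSubmonoid Λ) (I : Set Λ) : Prop :=
  I ⊆ (M : Set Λ) ∧ ∀ i ∈ I, ∀ m ∈ M, i + m ∈ I

/-- A prime ideal of the monoid `M`: an ideal `p ≠ M` such that `x + y ∈ p` implies `x ∈ p` or
`y ∈ p`.  The empty set counts as a prime ideal. -/
def IsPrimeMonIdeal (M : AddSubmonoid Λ) (p : Set Λ) : Prop :=
  IsMonIdeal M p ∧ p ≠ (M : Set Λ) ∧ ∀ x ∈ M, ∀ y ∈ M, x + y ∈ p → x ∈ p ∨ y ∈ p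

/-- The height of a prime ideal `p` of `M`: the supremum (in `ℕ∞`) of the lengths `n` of chains
`p₀ ⊊ p₁ ⊊ ⋯ ⊊ pₙ = p` of prime ideals of `M`. -/
noncomputable def primeHeight (M : AddSubmonoid Λ) (p : Set Λ) : ℕ∞ :=
  sSup {n : ℕ∞ | ∃ m : ℕ, n = (m : ℕ∞) ∧ ∃ c : Fin (m + 1) → Set Λ,
    (∀ i, IsPrimeMonIdeal M (c i)) ∧ StrictMono c ∧ c (Fin.last m) = p}

/-- A face of the monoid `M`: a submonoid `F ⊆ M` such that `x + y ∈ F` implies `x ∈ F` and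
`y ∈ F` for `x, y ∈ M`. -/
def IsFace (M : AddSubmonoid Λ) (F : Set Λ) : Prop :=
  F ⊆ (M : Set Λ) ∧ 0 ∈ F ∧ (∀ x ∈ F, ∀ y ∈ F, x + y ∈ F) ∧
    ∀ x ∈ M, ∀ y ∈ M, x + y ∈ F → x ∈ F ∧ y ∈ F

/-- A facet of `M`: a face of rank `rk(M) - 1`. -/
def IsFacet (M : AddSubmonoid Λ) (F : Set Λ) : Prop :=
  IsFace M F ∧ (setRank F : ℤ) = (monRank M : ℤ) - 1

/-- An edge of `M`: a face of rank `1`. -/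
def IsEdge (M : AddSubmonoid Λ) (E : Set Λ) : Prop :=
  IsFace M E ∧ setRank E = 1

/-- The face `N` splits off from `M`: there is a face `K` such that the addition map
`N × K → M` is bijective. -/
def SplitsOff (M : AddSubmonoid Λ) (N : Set Λ) : Prop :=
  ∃ K : Set Λ, IsFace M K ∧
    (∀ m ∈ M, ∃ a ∈ N, ∃ b ∈ K, m = a + b) ∧
    (∀ a ∈ N, ∀ b ∈ K, ∀ a' ∈ N, ∀ b' ∈ K, a + b = a' + b' → a = a' ∧ b = b')

/-- The canonical map `Λ → ℚ ⊗ Λ`. -/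
noncomputable abbrev toRat (Λ : Type*) [AddCommGroup Λ] :=
  TensorProduct.mk ℤ ℚ Λ (1 : ℚ)

/-- The rational subspace of `ℚ ⊗ Λ` spanned by a subset of `Λ`. -/
noncomputable def ratSpan (S : Set Λ) : Submodule ℚ (ℚ ⊗[ℤ] Λ) :=
  Submodule.span ℚ (toRat Λ '' S)

theorem setRank_eq_finrank_ratSpan (S : Set Λ) :
    setRank S = Module.finrank ℚ (ratSpan S) := by
  have e := Submodule.toBaseChange.toLinearEquiv ℚ (Submodule.span ℤ S)
  rw [Submodule.baseChange_span] at e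
  rw [ratSpan, ← e.finrank_eq, setRank, grpRank, ← Submodule.span_int_eq_addSubgroupClosure]
  rfl

theorem toRat_injective (h : ∀ (x : Λ) (n : ℕ), 0 < n → n • x = 0 → x = 0) :
    Function.Injective (toRat Λ) := by
  rw [injective_iff_map_eq_zero]
  intro x hx
  obtain ⟨c, hc⟩ := IsLocalizedModule.exists_of_eq (S := nonZeroDivisors ℤ) (f := toRat Λ)
    (x₁ := x) (x₂ := 0) (by simpa using hx)
  have hc0 : (c : ℤ) ≠ 0 := nonZeroDivisors.ne_zero c.2
  refine h x (c : ℤ).natAbs (Int.natAbs_pos.2 hc0) ?_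
  have hcx : (c : ℤ) • x = 0 := by simpa [Submonoid.smul_def] using hc
  rcases Int.natAbs_eq (c : ℤ) with h' | h'
  · rwa [h', natCast_zsmul] at hcx
  · rwa [h', neg_smul, neg_eq_zero, natCast_zsmul] at hcx

theorem exists_smul_eq_of_mem_ratSpan {S : Set Λ} {z : ℚ ⊗[ℤ] Λ} (hz : z ∈ ratSpan S) :
    ∃ n : ℕ, 0 < n ∧ ∃ a ∈ AddSubgroup.closure S, n • z = toRat Λ a := by
  induction hz using Submodule.span_induction with
  | mem x hx =>
    obtain ⟨a, ha, rfl⟩ := hx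
    exact ⟨1, one_pos, a, AddSubgroup.subset_closure ha, one_nsmul _⟩
  | zero => exact ⟨1, one_pos, 0, zero_mem _, by simp⟩
  | add x y _ _ hx hy =>
    obtain ⟨n, hn, a, ha, hxa⟩ := hx
    obtain ⟨k, hk, b, hb, hyb⟩ := hy
    refine ⟨n * k, Nat.mul_pos hn hk, k • a + n • b,
      add_mem (nsmul_mem ha _) (nsmul_mem hb _), ?_⟩
    rw [map_add, map_nsmul, map_nsmul, ← hxa, ← hyb]
    module
  | smul q x _ hx =>
    obtain ⟨n, hn, a, ha, hxa⟩ := hx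
    refine ⟨q.den * n, Nat.mul_pos q.den_pos hn, q.num • a, zsmul_mem ha _, ?_⟩
    rw [map_zsmul, ← hxa, ← Nat.cast_smul_eq_nsmul ℚ, ← Nat.cast_smul_eq_nsmul ℚ,
      ← Int.cast_smul_eq_zsmul ℚ, smul_smul, smul_smul]
    congr 1
    push_cast
    rw [← Rat.den_mul_eq_num q]
    ring

theorem toRat_mem_ratSpan_of_mem_closure {S : Set Λ} {a : Λ} (ha : a ∈ AddSubgroup.closure S) :
    toRat Λ a ∈ ratSpan S := by
  induction ha using AddSubgroup.closure_induction with
  | mem x hx => exact Submodule.subset_span ⟨x, hx, rfl⟩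
  | zero => simp
  | add x y _ _ hx hy => rw [map_add]; exact add_mem hx hy
  | neg x _ hx => rw [map_neg]; exact neg_mem hx

theorem mem_of_nsmul_mem {S : Submodule ℚ (ℚ ⊗[ℤ] Λ)} {n : ℕ} (hn : 0 < n) {z : ℚ ⊗[ℤ] Λ}
    (h : n • z ∈ S) : z ∈ S := by
  rw [← Nat.cast_smul_eq_nsmul ℚ] at h
  exact (S.smul_mem_iff (by exact_mod_cast hn.ne')).1 h

theorem ratSpan_mono {S T : Set Λ} (h : S ⊆ T) : ratSpan S ≤ ratSpan T :=
  Submodule.span_mono (Set.image_mono h)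

/-! ### Faces and primes -/

namespace IsFace

variable {M : AddSubmonoid Λ} {F : Set Λ}

/-- A face, as a submonoid. -/
def toAddSubmonoid (hF : IsFace M F) : AddSubmonoid Λ where
  carrier := F
  zero_mem' := hF.2.1
  add_mem' := fun {a b} ha hb => hF.2.2.1 a ha b hb

theorem nsmul_mem (hF : IsFace M F) {x : Λ} (hx : x ∈ F) (n : ℕ) : n • x ∈ F :=
  AddSubmonoid.nsmul_mem hF.toAddSubmonoid hx n

theorem mem_of_nsmul_mem (hF : IsFace M F) {x : Λ} (hx : x ∈ M) {n : ℕ} (hn : 0 < n)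
    (h : n • x ∈ F) : x ∈ F := by
  obtain ⟨k, rfl⟩ := Nat.exists_eq_succ_of_ne_zero hn.ne'
  rw [Nat.succ_eq_add_one, succ_nsmul] at h
  exact (hF.2.2.2 _ (AddSubmonoid.nsmul_mem M hx k) _ hx h).2

theorem exists_sub_of_mem_closure (hF : IsFace M F) {h : Λ}
    (hh : h ∈ AddSubgroup.closure F) : ∃ a ∈ F, ∃ b ∈ F, h = a - b := by
  induction hh using AddSubgroup.closure_induction with
  | mem x hx => exact ⟨x, hx, 0, hF.2.1, by simp⟩
  | zero => exact ⟨0, hF.2.1, 0, hF.2.1, by simp⟩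
  | add x y _ _ hx hy =>
    obtain ⟨a, ha, b, hb, rfl⟩ := hx
    obtain ⟨c, hc, d, hd, rfl⟩ := hy
    exact ⟨a + c, hF.2.2.1 _ ha _ hc, b + d, hF.2.2.1 _ hb _ hd, by abel⟩
  | neg x _ hx =>
    obtain ⟨a, ha, b, hb, rfl⟩ := hx
    exact ⟨b, hb, a, ha, by abel⟩

theorem mem_of_mem_closure (hF : IsFace M F) {x : Λ} (hx : x ∈ M)
    (h : x ∈ AddSubgroup.closure F) : x ∈ F := by
  obtain ⟨a, ha, b, hb, hab⟩ := hF.exists_sub_of_mem_closure h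
  exact (hF.2.2.2 x hx b (hF.1 hb) (by rwa [hab, sub_add_cancel])).1

theorem mem_of_toRat_mem (hF : IsFace M F)
    (tf : ∀ (x : Λ) (n : ℕ), 0 < n → n • x = 0 → x = 0) {x : Λ} (hx : x ∈ M)
    (h : toRat Λ x ∈ ratSpan F) : x ∈ F := by
  obtain ⟨n, hn, a, ha, hxa⟩ := exists_smul_eq_of_mem_ratSpan h
  rw [← map_nsmul] at hxa
  have hnx := toRat_injective tf hxa
  exact hF.mem_of_nsmul_mem hx hn
    (hF.mem_of_mem_closure (AddSubmonoid.nsmul_mem M hx n) (hnx ▸ ha))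

theorem isPrimeMonIdeal_diff (hF : IsFace M F) : IsPrimeMonIdeal M ((M : Set Λ) \ F) := by
  refine ⟨⟨Set.sdiff_subset, fun i hi m hm => ⟨add_mem hi.1 hm, fun h =>
    hi.2 (hF.2.2.2 _ hi.1 _ hm h).1⟩⟩, fun h => ?_, fun x hx y hy h => ?_⟩
  · have h0 : (0 : Λ) ∈ (M : Set Λ) \ F := h.symm ▸ (M.zero_mem : (0 : Λ) ∈ (M : Set Λ))
    exact h0.2 hF.2.1
  · by_contra! hc
    have hxF : x ∈ F := by_contra fun hx' => hc.1 ⟨hx, hx'⟩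
    have hyF : y ∈ F := by_contra fun hy' => hc.2 ⟨hy, hy'⟩
    exact h.2 (hF.2.2.1 _ hxF _ hyF)

theorem setRank_lt (tf : ∀ (x : Λ) (n : ℕ), 0 < n → n • x = 0 → x = 0)
    [Module.Finite ℤ Λ] (hF : IsFace M F) {G : Set Λ} (hFG : F ⊂ G) (hG : G ⊆ M) :
    setRank F < setRank G := by
  rw [setRank_eq_finrank_ratSpan, setRank_eq_finrank_ratSpan]
  refine Submodule.finrank_lt_finrank_of_lt (lt_of_le_of_ne (ratSpan_mono hFG.1) fun h => ?_)
  obtain ⟨x, hxG, hxF⟩ := Set.exists_of_ssubset hFG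
  refine hxF (hF.mem_of_toRat_mem tf (hG hxG) ?_)
  rw [h]
  exact Submodule.subset_span ⟨x, hxG, rfl⟩

end IsFace

theorem IsPrimeMonIdeal.isFace_diff {M : AddSubmonoid Λ} {p : Set Λ}
    (hp : IsPrimeMonIdeal M p) : IsFace M ((M : Set Λ) \ p) := by
  obtain ⟨⟨hsub, hadd⟩, hne, hprime⟩ := hp
  refine ⟨Set.sdiff_subset, ⟨M.zero_mem, fun h0 => hne ?_⟩, fun x hx y hy =>
    ⟨add_mem hx.1 hy.1, fun h => ?_⟩, fun x hx y hy h => ⟨⟨hx, fun h' => ?_⟩, ⟨hy, fun h' => ?_⟩⟩⟩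
  · exact hsub.antisymm fun m hm => by simpa using hadd 0 h0 m hm
  · rcases hprime _ hx.1 _ hy.1 h with h | h
    exacts [hx.2 h, hy.2 h]
  · exact h.2 (hadd _ h' _ hy)
  · exact h.2 (add_comm y x ▸ hadd _ h' _ hx)

/-- The elements of `Λ` having a positive multiple in `L`. -/
def AddSubmonoid.rootClosure (L : AddSubmonoid Λ) : AddSubmonoid Λ where
  carrier := {x | ∃ n : ℕ, 0 < n ∧ n • x ∈ L}
  zero_mem' := ⟨1, one_pos, by simp⟩
  add_mem' := by
    rintro x y ⟨n, hn, hx⟩ ⟨k, hk, hy⟩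
    refine ⟨n * k, Nat.mul_pos hn hk, ?_⟩
    rw [show (n * k) • (x + y) = k • n • x + n • k • y by module]
    exact add_mem (nsmul_mem hx _) (nsmul_mem hy _)

theorem AddSubmonoid.le_rootClosure (L : AddSubmonoid Λ) : L ≤ L.rootClosure :=
  fun x hx => ⟨1, one_pos, by simpa using hx⟩

theorem AddSubmonoid.rootClosure_le_rootClosure {L L' : AddSubmonoid Λ} (h : L ≤ L'.rootClosure) :
    L.rootClosure ≤ L'.rootClosure := by
  rintro x ⟨n, hn, hx⟩
  obtain ⟨k, hk, hx⟩ := h hx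
  exact ⟨k * n, Nat.mul_pos hk hn, by rwa [mul_smul]⟩

/-- The submonoid generated by `T` and the group generated by `F`. -/
def coneOver (F T : Set Λ) : AddSubmonoid Λ :=
  AddSubmonoid.closure T ⊔ (AddSubgroup.closure F).toAddSubmonoid

theorem mem_coneOver {F T : Set Λ} {x : Λ} : x ∈ coneOver F T ↔
    ∃ t ∈ AddSubmonoid.closure T, ∃ h ∈ AddSubgroup.closure F, t + h = x := by
  simp [coneOver, AddSubmonoid.mem_sup]

theorem coneOver_le_rootClosure {F T T' : Set Λ} (h : T ⊆ (coneOver F T').rootClosure) :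
    coneOver F T ≤ (coneOver F T').rootClosure :=
  sup_le (AddSubmonoid.closure_le.2 h) (le_sup_right.trans (AddSubmonoid.le_rootClosure _))

theorem toRat_mem_of_mem_rootClosure_coneOver {F T : Set Λ} {x : Λ}
    (h : x ∈ (coneOver F T).rootClosure) : toRat Λ x ∈ ratSpan T ⊔ ratSpan F := by
  obtain ⟨n, hn, hx⟩ := h
  obtain ⟨t, ht, f, hf, hx⟩ := mem_coneOver.1 hx
  refine mem_of_nsmul_mem hn ?_
  rw [← map_nsmul, ← hx, map_add]
  exact Submodule.add_mem_sup
    (toRat_mem_ratSpan_of_mem_closure (AddSubgroup.le_closure_toAddSubmonoid T ht))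
    (toRat_mem_ratSpan_of_mem_closure hf)

theorem exists_nsmul_eq_of_mem_rootClosure_coneOver {F T : Set Λ} {v : Λ} (hv : v ∈ T) {x : Λ}
    (hx : x ∈ (coneOver F T).rootClosure) :
    ∃ n : ℕ, 0 < n ∧ ∃ b : ℕ, ∃ t ∈ AddSubmonoid.closure (T \ {v}),
      ∃ h ∈ AddSubgroup.closure F, n • x = b • v + t + h := by
  obtain ⟨n, hn, hx⟩ := hx
  obtain ⟨s, hs, h, hh, hx⟩ := mem_coneOver.1 hx
  rw [← Set.insert_sdiff_self_of_mem hv, Set.insert_eq, AddSubmonoid.closure_union,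
    AddSubmonoid.mem_sup] at hs
  obtain ⟨b, hb, t, ht, rfl⟩ := hs
  obtain ⟨b, rfl⟩ := AddSubmonoid.mem_closure_singleton.1 hb
  exact ⟨n, hn, b, t, ht, h, hh, hx.symm⟩

theorem exists_add_eq_of_nsmul_eq (H : AddSubgroup Λ) {n n₁ n₂ a b c : ℕ}
    {v x y x' y' h h₁ h₂ : Λ} (hh : h ∈ H) (hh₁ : h₁ ∈ H) (hh₂ : h₂ ∈ H)
    (hxy : a • v + h = n • (x + y)) (hx : n₁ • x = b • v + x' + h₁)
    (hy : n₂ • y = c • v + y' + h₂) :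
    ∃ h₃ ∈ H, (n₁ * n₂ * a) • v + h₃ =
      (n * n₂ * b + n * n₁ * c) • v + ((n * n₂) • x' + (n * n₁) • y') := by
  refine ⟨(n₁ * n₂) • h - (n * n₂) • h₁ - (n * n₁) • h₂,
    sub_mem (sub_mem (nsmul_mem hh _) (nsmul_mem hh₁ _)) (nsmul_mem hh₂ _), ?_⟩
  have e : (n₁ * n₂) • (a • v + h) =
      (n * n₂) • (b • v + x' + h₁) + (n * n₁) • (c • v + y' + h₂) := by
    rw [hxy, ← hx, ← hy]
    module
  have e' : (n₁ * n₂ * a) • v + ((n₁ * n₂) • h - (n * n₂) • h₁ - (n * n₁) • h₂) =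
    (n₁ * n₂) • (a • v + h) - (n * n₂) • h₁ - (n * n₁) • h₂ := by module
  rw [e', e]
  module

/-- If `T` is a system of cone generators of `M` modulo the face `F` in which `v` is not redundant,
then `v` and `F` span a face of `M`. -/
theorem isFace_inf_rootClosure_coneOver {M : AddSubmonoid Λ} {F : Set Λ} (hF : IsFace M F)
    {T : Set Λ} (hTM : T ⊆ M) (hT : M ≤ (coneOver F T).rootClosure) {v : Λ} (hv : v ∈ T)
    (hvT : v ∉ (coneOver F (T \ {v})).rootClosure) :
    IsFace M (M ⊓ (coneOver F {v}).rootClosure : AddSubmonoid Λ) := by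
  have key : ∀ x ∈ M, ∀ y ∈ M, x + y ∈ (coneOver F {v}).rootClosure →
      x ∈ (coneOver F {v}).rootClosure := by
    intro x hx y hy hxy
    obtain ⟨n, hn, hxy⟩ := hxy
    obtain ⟨a, ha, h, hh, hxy⟩ := mem_coneOver.1 hxy
    obtain ⟨a, rfl⟩ := AddSubmonoid.mem_closure_singleton.1 ha
    obtain ⟨n₁, hn₁, b, x', hx', h₁, hh₁, hx₁⟩ :=
      exists_nsmul_eq_of_mem_rootClosure_coneOver hv (hT hx)
    obtain ⟨n₂, hn₂, c, y', hy', h₂, hh₂, hy₂⟩ :=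
      exists_nsmul_eq_of_mem_rootClosure_coneOver hv (hT hy)
    have hle : AddSubmonoid.closure (T \ {v}) ≤ M :=
      AddSubmonoid.closure_le.2 (Set.sdiff_subset.trans hTM)
    obtain ⟨h₃, hh₃, heq⟩ := exists_add_eq_of_nsmul_eq _ hh hh₁ hh₂ hxy hx₁ hy₂
    have hz : (n * n₂) • x' + (n * n₁) • y' ∈ AddSubmonoid.closure (T \ {v}) :=
      add_mem (nsmul_mem hx' _) (nsmul_mem hy' _)
    rcases lt_or_ge (n * n₂ * b + n * n₁ * c) (n₁ * n₂ * a) with hlt | hge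
    · obtain ⟨d, hd⟩ := Nat.exists_eq_add_of_lt hlt
      refine absurd ⟨d + 1, Nat.succ_pos d, mem_coneOver.2 ⟨_, hz, -h₃, neg_mem hh₃, ?_⟩⟩ hvT
      rw [hd, show n * n₂ * b + n * n₁ * c + d + 1 = n * n₂ * b + n * n₁ * c + (d + 1) by ring,
        add_smul, add_assoc] at heq
      rw [← add_left_cancel heq]
      abel
    · obtain ⟨d, hd⟩ := Nat.exists_eq_add_of_le hge
      rw [hd, add_smul, add_assoc] at heq
      obtain ⟨f₁, hf₁, f₂, hf₂, hf⟩ := hF.exists_sub_of_mem_closure hh₃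
      have hxF' := add_left_cancel heq
      rw [hf] at hxF'
      have hF₁ : (d • v + f₂ + (n * n₁) • y') + (n * n₂) • x' ∈ F := by
        have : (d • v + f₂ + (n * n₁) • y') + (n * n₂) • x' =
          d • v + ((n * n₂) • x' + (n * n₁) • y') + f₂ := by abel
        rw [this, ← hxF', sub_add_cancel]
        exact hf₁
      have hxF : x' ∈ F := by
        refine hF.mem_of_nsmul_mem (hle hx') (Nat.mul_pos hn hn₂) (hF.2.2.2 _ ?_ _ ?_ hF₁).2
        · exact add_mem (add_mem (AddSubmonoid.nsmul_mem M (hTM hv) _) (hF.1 hf₂))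
            (AddSubmonoid.nsmul_mem M (hle hy') _)
        · exact AddSubmonoid.nsmul_mem M (hle hx') _
      refine ⟨n₁, hn₁, mem_coneOver.2 ⟨b • v, AddSubmonoid.mem_closure_singleton.2 ⟨b, rfl⟩,
        x' + h₁, add_mem (AddSubgroup.subset_closure hxF) hh₁, ?_⟩⟩
      rw [hx₁]
      abel
  refine ⟨fun x hx => hx.1, zero_mem _, fun x hx y hy => add_mem hx hy, fun x hx y hy h =>
    ⟨⟨hx, key x hx y hy h.2⟩, ⟨hy, key y hy x hx (add_comm x y ▸ h.2)⟩⟩⟩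

theorem IsFace.exists_ssubset_setRank_le {M : AddSubmonoid Λ} [Module.Finite ℤ Λ] (hfg : M.FG)
    {F : Set Λ} (hF : IsFace M F) (hlt : setRank F < monRank M) :
    ∃ G, IsFace M G ∧ F ⊂ G ∧ setRank G ≤ setRank F + 1 := by
  classical
  obtain ⟨S, hS⟩ := hfg
  obtain ⟨T, hTS, hT, hmin⟩ := exists_minimal_le_of_wellFoundedLT
    (fun T : Finset Λ => M ≤ (coneOver F (T : Set Λ)).rootClosure) S
    (by rw [← hS]; exact le_sup_left.trans (AddSubmonoid.le_rootClosure _))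
  have hTM : (T : Set Λ) ⊆ M := by
    rw [← hS]
    exact (Finset.coe_subset.2 hTS).trans AddSubmonoid.subset_closure
  obtain ⟨v, hv⟩ : T.Nonempty := by
    by_contra hne
    rw [Finset.not_nonempty_iff_eq_empty] at hne
    subst hne
    refine hlt.not_ge ?_
    rw [monRank, setRank_eq_finrank_ratSpan, setRank_eq_finrank_ratSpan]
    refine Submodule.finrank_mono (Submodule.span_le.2 ?_)
    rintro _ ⟨x, hx, rfl⟩
    simpa [ratSpan] using toRat_mem_of_mem_rootClosure_coneOver (hT hx)
  have hvT : v ∉ (coneOver F ((T : Set Λ) \ {v})).rootClosure := by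
    intro hmem
    have hle : M ≤ (coneOver F ((T.erase v : Finset Λ) : Set Λ)).rootClosure := by
      refine hT.trans (AddSubmonoid.rootClosure_le_rootClosure (coneOver_le_rootClosure ?_))
      rw [Finset.coe_erase]
      intro x hx
      by_cases hxv : x = v
      · exact hxv ▸ hmem
      · exact AddSubmonoid.le_rootClosure _
          (AddSubmonoid.mem_sup_left (AddSubmonoid.subset_closure ⟨hx, hxv⟩))
    exact Finset.notMem_erase v T (hmin hle (Finset.erase_subset v T) hv)
  refine ⟨_, isFace_inf_rootClosure_coneOver hF hTM hT hv hvT, ⟨fun x hx => ⟨hF.1 hx, ?_⟩,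
    fun h => ?_⟩, ?_⟩
  · exact AddSubmonoid.le_rootClosure _
      (AddSubmonoid.mem_sup_right (AddSubgroup.subset_closure hx))
  · refine hvT (AddSubmonoid.le_rootClosure _
      (AddSubmonoid.mem_sup_right (AddSubgroup.subset_closure (h ⟨hTM hv, ?_⟩))))
    exact AddSubmonoid.le_rootClosure _
      (AddSubmonoid.mem_sup_left (AddSubmonoid.subset_closure (Set.mem_singleton v)))
  · rw [setRank_eq_finrank_ratSpan, setRank_eq_finrank_ratSpan]
    have hle : ratSpan ((M ⊓ (coneOver F {v}).rootClosure : AddSubmonoid Λ) : Set Λ) ≤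
        ratSpan {v} ⊔ ratSpan F := by
      refine Submodule.span_le.2 ?_
      rintro _ ⟨x, hx, rfl⟩
      exact toRat_mem_of_mem_rootClosure_coneOver hx.2
    have hv1 : Module.finrank ℚ (ratSpan {v}) ≤ 1 := by
      rw [ratSpan, Set.image_singleton]
      have h := finrank_span_finset_le_card (R := ℚ) {toRat Λ v}
      rwa [Finset.coe_singleton, Finset.card_singleton] at h
    have h1 := Submodule.finrank_mono hle
    have h2 := Submodule.finrank_add_le_finrank_add_finrank (ratSpan {v}) (ratSpan F)
    lia

theorem IsFace.exists_strictMono_primes {M : AddSubmonoid Λ} [Module.Finite ℤ Λ] (hfg : M.FG)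
    (n : ℕ) {F : Set Λ} (hF : IsFace M F) (hn : setRank F + n ≤ monRank M) :
    ∃ c : Fin (n + 1) → Set Λ, (∀ i, IsPrimeMonIdeal M (c i)) ∧ StrictMono c ∧
      c (Fin.last n) = (M : Set Λ) \ F := by
  induction n generalizing F with
  | zero =>
    exact ⟨fun _ => (M : Set Λ) \ F, fun _ => hF.isPrimeMonIdeal_diff,
      fun i j h => absurd h (by lia), rfl⟩
  | succ n ih =>
    obtain ⟨G, hG, hFG, hrank⟩ := hF.exists_ssubset_setRank_le hfg (by lia)
    obtain ⟨c, hc, hmono, hlast⟩ := ih hG (by lia)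
    refine ⟨Fin.snoc c ((M : Set Λ) \ F), fun i => ?_, ?_, by simp⟩
    · induction i using Fin.lastCases with
      | last => simpa using hF.isPrimeMonIdeal_diff
      | cast i => simpa using hc i
    · rw [Fin.strictMono_iff_lt_succ]
      intro i
      induction i using Fin.lastCases with
      | last =>
        rw [Fin.snoc_castSucc, Fin.succ_last, Fin.snoc_last, hlast]
        obtain ⟨x, hxG, hxF⟩ := Set.exists_of_ssubset hFG
        exact ⟨Set.sdiff_subset_sdiff_right hFG.1, fun h => (h ⟨hG.1 hxG, hxF⟩).2 hxG⟩
      | cast i =>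
        rw [Fin.snoc_castSucc, Fin.succ_castSucc, Fin.snoc_castSucc]
        exact hmono i.castSucc_lt_succ

theorem setRank_mono [Module.Finite ℤ Λ] {S T : Set Λ} (h : S ⊆ T) : setRank S ≤ setRank T := by
  rw [setRank_eq_finrank_ratSpan, setRank_eq_finrank_ratSpan]
  exact Submodule.finrank_mono (ratSpan_mono h)

theorem primeHeight_eq {M : AddSubmonoid Λ} [Module.Finite ℤ Λ] (hfg : M.FG)
    (tf : ∀ (x : Λ) (n : ℕ), 0 < n → n • x = 0 → x = 0) {p : Set Λ} (hp : IsPrimeMonIdeal M p) :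
    primeHeight M p = ((monRank M - setRank ((M : Set Λ) \ p) : ℕ) : ℕ∞) := by
  have hle : setRank ((M : Set Λ) \ p) ≤ monRank M := setRank_mono Set.sdiff_subset
  refine le_antisymm (sSup_le ?_) (le_sSup ?_)
  · rintro _ ⟨m, rfl, c, hc, hmono, rfl⟩
    have key : ∀ i : Fin (m + 1), setRank ((M : Set Λ) \ c i) + i ≤ monRank M := by
      intro i
      induction i using Fin.induction with
      | zero => exact setRank_mono Set.sdiff_subset
      | succ i ih =>
        have hlt : c i.castSucc ⊂ c i.succ := hmono i.castSucc_lt_succ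
        have hss : (M : Set Λ) \ c i.succ ⊂ (M : Set Λ) \ c i.castSucc := by
          obtain ⟨x, hx, hx'⟩ := Set.exists_of_ssubset hlt
          exact ⟨Set.sdiff_subset_sdiff_right hlt.1, fun h => (h ⟨(hc _).1.1 hx, hx'⟩).2 hx⟩
        have := (hc i.succ).isFace_diff.setRank_lt tf hss Set.sdiff_subset
        simp only [Fin.val_succ, Fin.val_castSucc] at ih ⊢
        lia
    have := key (Fin.last m)
    rw [Fin.val_last] at this
    exact_mod_cast Nat.le_sub_of_add_le' this
  · obtain ⟨c, hc, hmono, hlast⟩ := hp.isFace_diff.exists_strictMono_primes hfg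
      (monRank M - setRank ((M : Set Λ) \ p)) (by lia)
    exact ⟨_, rfl, c, hc, hmono, by rw [hlast, Set.sdiff_sdiff_cancel_left hp.1.1]⟩

/-! ### Splitting -/

theorem wellFounded_add_of_isSharp {M : AddSubmonoid Λ} (hfg : M.FG) (hsharp : IsSharp M) :
    WellFounded (fun x y : M => ∃ a ∈ M, a ≠ 0 ∧ (y : Λ) = a + x) := by
  obtain ⟨S, hS⟩ := hfg
  have : IsTrans M (fun x y : M => ∃ a ∈ M, a ≠ 0 ∧ (y : Λ) = a + x) :=
    ⟨fun x y z ⟨a, ha, ha0, hy⟩ ⟨b, hb, _, hz⟩ => ⟨b + a, add_mem hb ha,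
      fun h => ha0 (hsharp a ha b hb (by rwa [add_comm])), by rw [hz, hy, add_assoc]⟩⟩
  have : Std.Irrefl (fun x y : M => ∃ a ∈ M, a ≠ 0 ∧ (y : Λ) = a + x) :=
    ⟨fun x ⟨a, _, ha0, hx⟩ => ha0 (by simpa using hx)⟩
  have : IsStrictOrder M (fun x y : M => ∃ a ∈ M, a ≠ 0 ∧ (y : Λ) = a + x) := {}
  rw [RelEmbedding.wellFounded_iff_isEmpty]
  refine ⟨fun f => ?_⟩
  have hlift : ∀ x : M, ∃ v : S → ℕ, (x : Λ) = ∑ i : S, v i • i.1 := fun x =>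
    AddSubmonoid.mem_closure_finset'.1 (hS ▸ x.2)
  choose v hv using hlift
  obtain ⟨i, j, hij, hle⟩ := wellQuasiOrdered_le (fun k => v (f k))
  obtain ⟨a, ha, ha0, hfa⟩ := f.map_rel_iff.2 (show j > i from hij)
  have hb : ∑ s : S, (v (f j) s - v (f i) s) • s.1 ∈ M :=
    sum_mem fun s _ => nsmul_mem (hS ▸ AddSubmonoid.subset_closure s.2) _
  have hj : (f j : Λ) = f i + ∑ s : S, (v (f j) s - v (f i) s) • s.1 := by
    rw [hv (f j), hv (f i), ← Finset.sum_add_distrib]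
    refine Finset.sum_congr rfl fun s _ => ?_
    rw [← add_smul, Nat.add_sub_cancel' (hle s)]
  refine ha0 (hsharp a ha _ hb ?_)
  rw [hfa, add_right_comm] at hj
  exact right_eq_add.1 hj

theorem exists_add_of_face {M : AddSubmonoid Λ} (hfg : M.FG) (hsharp : IsSharp M)
    {N : Set Λ} (hN : IsFace M N) (x : M) :
    ∃ a ∈ N, ∃ b ∈ (M : Set Λ) \ ((N \ {0}) + (M : Set Λ)), (x : Λ) = a + b := by
  induction x using (wellFounded_add_of_isSharp hfg hsharp).induction with
  | _ x ih =>
    by_cases hx : (x : Λ) ∈ (N \ {0}) + (M : Set Λ)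
    · obtain ⟨n, hn, m, hm, hx⟩ := hx
      obtain ⟨a, ha, b, hb, hab⟩ := ih ⟨m, hm⟩ ⟨n, hN.1 hn.1, hn.2, hx.symm⟩
      refine ⟨n + a, hN.2.2.1 _ hn.1 _ ha, b, hb, ?_⟩
      rw [← hx, add_assoc, ← hab]
    · exact ⟨0, hN.2.1, x, ⟨x.2, hx⟩, by simp⟩

theorem SplitsOff.diff_eq {M : AddSubmonoid Λ} {N K : Set Λ}
    (hN : IsFace M N) (hK : IsFace M K) (hsurj : ∀ m ∈ M, ∃ a ∈ N, ∃ b ∈ K, m = a + b)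
    (hinj : ∀ a ∈ N, ∀ b ∈ K, ∀ a' ∈ N, ∀ b' ∈ K, a + b = a' + b' → a = a' ∧ b = b') :
    (N \ {0}) + (M : Set Λ) = (M : Set Λ) \ K := by
  ext x
  constructor
  · rintro ⟨n, hn, m, hm, rfl⟩
    refine ⟨add_mem (hN.1 hn.1) hm, fun hx => hn.2 ?_⟩
    have hnK := (hK.2.2.2 _ (hN.1 hn.1) _ hm hx).1
    exact (hinj n hn.1 0 hK.2.1 0 hN.2.1 n hnK (by abel)).1
  · rintro ⟨hx, hxK⟩
    obtain ⟨a, ha, b, hb, rfl⟩ := hsurj x hx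
    refine ⟨a, ⟨ha, fun h => hxK ?_⟩, b, hK.1 hb, rfl⟩
    rw [Set.mem_singleton_iff.1 h, zero_add]
    exact hb

/-- Unique decomposability for two faces is the same as independence of their rational spans. -/
theorem ratSpan_inf_eq_bot_iff {M : AddSubmonoid Λ}
    (tf : ∀ (x : Λ) (n : ℕ), 0 < n → n • x = 0 → x = 0) {N K : Set Λ}
    (hN : IsFace M N) (hK : IsFace M K) :
    ratSpan K ⊓ ratSpan N = ⊥ ↔
      ∀ a ∈ N, ∀ b ∈ K, ∀ a' ∈ N, ∀ b' ∈ K, a + b = a' + b' → a = a' ∧ b = b' := by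
  constructor
  · intro h a ha b hb a' ha' b' hb' hab
    have hsub : a - a' = b' - b := by rw [sub_eq_sub_iff_add_eq_add, hab, add_comm]
    have hmem : toRat Λ (a - a') ∈ ratSpan K ⊓ ratSpan N := by
      refine ⟨?_, toRat_mem_ratSpan_of_mem_closure
        (sub_mem (AddSubgroup.subset_closure ha) (AddSubgroup.subset_closure ha'))⟩
      rw [hsub]
      exact toRat_mem_ratSpan_of_mem_closure
        (sub_mem (AddSubgroup.subset_closure hb') (AddSubgroup.subset_closure hb))
    rw [h, Submodule.mem_bot] at hmem
    have h0 := (injective_iff_map_eq_zero _).1 (toRat_injective tf) _ hmem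
    exact ⟨sub_eq_zero.1 h0, (sub_eq_zero.1 (hsub ▸ h0)).symm⟩
  · intro hinj
    rw [eq_bot_iff]
    rintro z ⟨hzK, hzN⟩
    obtain ⟨n, hn, x, hx, hzx⟩ := exists_smul_eq_of_mem_ratSpan hzK
    obtain ⟨k, hk, y, hy, hzy⟩ := exists_smul_eq_of_mem_ratSpan hzN
    have hxy : k • x = n • y := by
      refine toRat_injective tf ?_
      rw [map_nsmul, map_nsmul, ← hzx, ← hzy, smul_comm]
    obtain ⟨b, hb, b', hb', hbb⟩ := hK.exists_sub_of_mem_closure (nsmul_mem hx k)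
    obtain ⟨a, ha, a', ha', haa⟩ := hN.exists_sub_of_mem_closure (nsmul_mem hy n)
    have hab := (hinj a ha b' hb' a' ha' b hb (by
      rw [add_comm a' b, ← sub_eq_sub_iff_add_eq_add, ← haa, ← hxy, hbb])).1
    rw [hab, sub_self, ← hxy] at haa
    have hx0 := tf x k hk haa
    rw [hx0, map_zero] at hzx
    exact mem_of_nsmul_mem hn (by rw [hzx]; exact zero_mem _)

theorem IsToric.finite {M : AddSubmonoid Λ} (hM : IsToric M) : Module.Finite ℤ Λ := by
  obtain ⟨⟨S, hS⟩, htop, -⟩ := hM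
  refine ⟨⟨S, ?_⟩⟩
  apply Submodule.toAddSubgroup_injective
  rw [Submodule.span_int_eq_addSubgroupClosure]
  refine top_unique ?_
  change ⊤ ≤ AddSubgroup.closure (S : Set Λ)
  rw [← htop, AddSubgroup.closure_le, ← hS]
  exact AddSubgroup.le_closure_toAddSubmonoid _

/-- Lemma `splitlem`. Let `M` be a sharp toric monoid with a face `N`.
The following are equivalent: (a) `N` splits off; (b) the ideal `(N⁺) = N⁺ + M` is prime
and `height((N⁺)) ≥ rk(N)`; (c) `(N⁺)` is prime and the face `K = M ∖ (N⁺)` satisfies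
`rk(K) + rk(N) ≤ rk(M)`. -/
theorem statement0 (M : AddSubmonoid Λ) (hM : IsToric M) (hsharp : IsSharp M)
    (N : Set Λ) (hN : IsFace M N) :
    (SplitsOff M N ↔
      (IsPrimeMonIdeal M ((N \ {0}) + (M : Set Λ)) ∧
        (setRank N : ℕ∞) ≤ primeHeight M ((N \ {0}) + (M : Set Λ)))) ∧
    ((IsPrimeMonIdeal M ((N \ {0}) + (M : Set Λ)) ∧
        (setRank N : ℕ∞) ≤ primeHeight M ((N \ {0}) + (M : Set Λ))) ↔
      (IsPrimeMonIdeal M ((N \ {0}) + (M : Set Λ)) ∧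
        setRank ((M : Set Λ) \ ((N \ {0}) + (M : Set Λ))) + setRank N ≤ monRank M)) := by
  have := hM.finite
  obtain ⟨hfg, -, tf, -⟩ := hM
  set p := (N \ {0}) + (M : Set Λ)
  have hbc : (IsPrimeMonIdeal M p ∧ (setRank N : ℕ∞) ≤ primeHeight M p) ↔
      (IsPrimeMonIdeal M p ∧ setRank ((M : Set Λ) \ p) + setRank N ≤ monRank M) := by
    refine and_congr_right fun hp => ?_
    have hle : setRank ((M : Set Λ) \ p) ≤ monRank M := setRank_mono Set.sdiff_subset
    rw [primeHeight_eq hfg tf hp, Nat.cast_le]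
    lia
  refine ⟨Iff.trans ⟨?_, ?_⟩ hbc.symm, hbc⟩
  · rintro ⟨K, hK, hsurj, hinj⟩
    have hpK : p = (M : Set Λ) \ K := SplitsOff.diff_eq hN hK hsurj hinj
    rw [hpK]
    refine ⟨hK.isPrimeMonIdeal_diff, ?_⟩
    rw [Set.sdiff_sdiff_cancel_left hK.1, monRank, setRank_eq_finrank_ratSpan,
      setRank_eq_finrank_ratSpan, setRank_eq_finrank_ratSpan,
      ← Submodule.finrank_sup_add_finrank_inf_eq, (ratSpan_inf_eq_bot_iff tf hN hK).2 hinj,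
      finrank_bot, add_zero]
    exact Submodule.finrank_mono (sup_le (ratSpan_mono hK.1) (ratSpan_mono hN.1))
  · rintro ⟨hp, hrank⟩
    have hK := hp.isFace_diff
    have hsurj : ∀ m ∈ M, ∃ a ∈ N, ∃ b ∈ (M : Set Λ) \ p, m = a + b :=
      fun m hm => exists_add_of_face hfg hsharp hN ⟨m, hm⟩
    refine ⟨_, hK, hsurj, (ratSpan_inf_eq_bot_iff tf hN hK).1 ?_⟩
    have hle : ratSpan (M : Set Λ) ≤ ratSpan ((M : Set Λ) \ p) ⊔ ratSpan N := by
      refine Submodule.span_le.2 ?_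
      rintro _ ⟨x, hx, rfl⟩
      obtain ⟨a, ha, b, hb, rfl⟩ := hsurj x hx
      rw [map_add, add_comm]
      exact Submodule.add_mem_sup (Submodule.subset_span ⟨b, hb, rfl⟩)
        (Submodule.subset_span ⟨a, ha, rfl⟩)
    rw [monRank, setRank_eq_finrank_ratSpan, setRank_eq_finrank_ratSpan,
      setRank_eq_finrank_ratSpan, ← Submodule.finrank_sup_add_finrank_inf_eq] at hrank
    have := Submodule.finrank_mono hle
    exact Submodule.finrank_eq_zero.1 (by lia)
end

section
/- Let P be a toric monoid, I ⊆ P a nonempty ideal, and a ∈ I. For an ideal J of P and n ≥ 1, let nJ denote the ideal {j₁ + ⋯ + jₙ : j₁,…,jₙ ∈ J}, and let J^sat = {x ∈ P : m·x ∈ mJ for some integer m ≥ 1}. For a subset S ⊆ P^gp, let P[S] denote the submonoid of P^gp generated by P and S, and for a submonoid Q of P^gp containing P let Q^sat = {x ∈ P^gp : n·x ∈ Q for some integer n ≥ 1}. Then there exists N ≥ 1 such that for every n ≥ N one has (P[{b − a : b ∈ I}])^sat = P[{c − n·a : c ∈ (nI)^sat}]. -/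
open scoped TensorProduct Pointwise

variable {Λ : Type*} [AddCommGroup Λ]

/-- `nJ`: the ideal of `n`-fold sums `j₁ + ⋯ + jₙ` of elements of `J`. -/
def sumIdeal (n : ℕ) (J : Set Λ) : Set Λ :=
  {x : Λ | ∃ f : Fin n → Λ, (∀ i, f i ∈ J) ∧ x = ∑ i, f i}

/-- `J^sat = {x ∈ P : m·x ∈ mJ for some m ≥ 1}`. -/
def idealSat (P : AddSubmonoid Λ) (J : Set Λ) : Set Λ :=
  {x : Λ | x ∈ P ∧ ∃ m : ℕ, 1 ≤ m ∧ m • x ∈ sumIdeal m J}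

theorem IsMonIdeal.exists_finite_generators {P : AddSubmonoid Λ} (hP : P.FG) {I : Set Λ}
    (hI : IsMonIdeal P I) :
    ∃ F : Set Λ, F.Finite ∧ F ⊆ I ∧ ∀ b ∈ I, ∃ c ∈ F, ∃ p ∈ P, b = c + p := by
  obtain ⟨T, rfl⟩ := hP
  let φ : (T → ℕ) → Λ := fun e => ∑ i, e i • (i : Λ)
  have hφ (e : T → ℕ) : φ e ∈ AddSubmonoid.closure (T : Set Λ) :=
    AddSubmonoid.mem_closure_finset'.2 ⟨e, rfl⟩
  have hpwo := Set.isPWO_of_wellQuasiOrderedLE (φ ⁻¹' I)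
  refine ⟨φ '' {e | Minimal (· ∈ φ ⁻¹' I) e},
    ((setOfPred_minimal_antichain _).finite_of_partiallyWellOrderedOn
      (hpwo.mono (setOfPred_minimal_subset _))).image φ, ?_, fun b hb => ?_⟩
  · rintro _ ⟨e, he, rfl⟩
    exact he.prop
  · obtain ⟨e, rfl⟩ := AddSubmonoid.mem_closure_finset'.1 (hI.1 hb)
    obtain ⟨d, hde, hd⟩ := hpwo.exists_le_minimal (a := e) hb
    obtain ⟨u, rfl⟩ := exists_add_of_le hde
    exact ⟨φ d, ⟨d, hd, rfl⟩, φ u, hφ u, by simp [φ, add_smul, Finset.sum_add_distrib]⟩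

theorem finite_setOf_nsmul_eq_sum [AddGroup.FG Λ] [IsAddTorsionFree Λ] (s : Finset Λ) :
    {x : Λ | ∃ k : ℕ, 1 ≤ k ∧ ∃ r : s → ℕ, (∀ q, r q ≤ k) ∧
      k • x = ∑ q, r q • (q : Λ)}.Finite := by
  have : Module.Finite ℤ Λ := Module.Finite.iff_addGroup_fg.2 inferInstance
  let B := Module.Free.chooseBasis ℤ Λ
  let M : Module.Free.ChooseBasisIndex ℤ Λ → ℤ := fun j => ∑ q : s, |B.repr (q : Λ) j|
  refine ((Set.finite_Icc (-M) M).preimage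
    (B.equivFun.injective.injOn (s := B.equivFun ⁻¹' Set.Icc (-M) M))).subset ?_
  rintro x ⟨k, hk, r, hr, hx⟩
  have key (j) : |B.repr x j| ≤ M j := by
    have hk' : (0 : ℤ) < k := by exact_mod_cast hk
    have h1 : (k : ℤ) * B.repr x j = ∑ q : s, (r q : ℤ) * B.repr (q : Λ) j := by
      have := congrArg (fun y => B.repr y j) hx
      simpa [Finsupp.finsetSum_apply] using this
    refine le_of_mul_le_mul_left ?_ hk'
    calc (k : ℤ) * |B.repr x j| = |(k : ℤ) * B.repr x j| := by rw [abs_mul, abs_of_pos hk']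
      _ ≤ ∑ q : s, |(r q : ℤ) * B.repr (q : Λ) j| := by
        rw [h1]; exact Finset.abs_sum_le_sum_abs _ _
      _ ≤ ∑ q : s, (k : ℤ) * |B.repr (q : Λ) j| := by
        refine Finset.sum_le_sum fun q _ => ?_
        rw [abs_mul, Nat.abs_cast]
        exact mul_le_mul_of_nonneg_right (by exact_mod_cast hr q) (abs_nonneg _)
      _ = k * M j := by rw [Finset.mul_sum]
  exact ⟨fun j => (abs_le.1 (key j)).1, fun j => (abs_le.1 (key j)).2⟩

/-- **Gordan's lemma**: the saturation of a finitely generated submonoid of a lattice is generated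
by the submonoid together with finitely many elements. -/
theorem exists_finite_generators_saturation [AddGroup.FG Λ] [IsAddTorsionFree Λ]
    {Q : AddSubmonoid Λ} (hQ : Q.FG) :
    ∃ F : Set Λ, F.Finite ∧ (∀ x ∈ F, ∃ k : ℕ, 1 ≤ k ∧ k • x ∈ Q) ∧
      ∀ x : Λ, (∃ k : ℕ, 1 ≤ k ∧ k • x ∈ Q) → ∃ q ∈ Q, ∃ y ∈ F, x = q + y := by
  obtain ⟨s, rfl⟩ := hQ
  refine ⟨_, finite_setOf_nsmul_eq_sum s, ?_, ?_⟩
  · rintro x ⟨k, hk, r, -, hx⟩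
    exact ⟨k, hk, AddSubmonoid.mem_closure_finset'.2 ⟨r, hx⟩⟩
  · rintro x ⟨k, hk, hx⟩
    obtain ⟨e, he⟩ := AddSubmonoid.mem_closure_finset'.1 hx
    refine ⟨∑ q, (e q / k) • (q : Λ), AddSubmonoid.mem_closure_finset'.2 ⟨_, rfl⟩,
      x - ∑ q, (e q / k) • (q : Λ),
      ⟨k, hk, fun q => e q % k, fun q => (Nat.mod_lt _ hk).le, ?_⟩, by abel⟩
    rw [smul_sub, he, Finset.smul_sum, ← Finset.sum_sub_distrib]
    refine Finset.sum_congr rfl fun q _ => ?_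
    rw [sub_eq_iff_eq_add, smul_smul, ← add_smul, Nat.mod_add_div]

theorem add_mem_sumIdeal {J : Set Λ} {m n : ℕ} {x y : Λ} (hx : x ∈ sumIdeal m J)
    (hy : y ∈ sumIdeal n J) : x + y ∈ sumIdeal (m + n) J := by
  obtain ⟨f, hf, rfl⟩ := hx
  obtain ⟨g, hg, rfl⟩ := hy
  refine ⟨Fin.append f g, fun i => ?_, by simp [Fin.sum_univ_add]⟩
  cases i using Fin.addCases <;> simp [hf, hg]

theorem nsmul_mem_sumIdeal {J : Set Λ} {a : Λ} (ha : a ∈ J) (n : ℕ) : n • a ∈ sumIdeal n J :=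
  ⟨fun _ => a, fun _ => ha, by simp⟩

theorem mem_sumIdeal_one {J : Set Λ} {a : Λ} (ha : a ∈ J) : a ∈ sumIdeal 1 J := by
  simpa using nsmul_mem_sumIdeal ha 1

theorem IsMonIdeal.sumIdeal_add_mem {P : AddSubmonoid Λ} {I : Set Λ} (hI : IsMonIdeal P I)
    {n : ℕ} (hn : 1 ≤ n) {x p : Λ} (hx : x ∈ sumIdeal n I) (hp : p ∈ P) :
    x + p ∈ sumIdeal n I := by
  obtain ⟨m, rfl⟩ := Nat.exists_eq_add_of_le' hn
  obtain ⟨f, hf, rfl⟩ := hx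
  rw [Fin.sum_univ_castSucc, add_assoc]
  exact add_mem_sumIdeal ⟨_, fun i => hf _, rfl⟩
    (mem_sumIdeal_one (hI.2 _ (hf _) _ hp))

theorem IsMonIdeal.sumIdeal_subset {P : AddSubmonoid Λ} {I : Set Λ} (hI : IsMonIdeal P I) (n : ℕ) :
    sumIdeal n I ⊆ P := by
  rintro _ ⟨f, hf, rfl⟩
  exact sum_mem fun i _ => hI.1 (hf i)

theorem sumIdeal_mul_subset (m n : ℕ) (J : Set Λ) :
    sumIdeal (m * n) J ⊆ sumIdeal m (sumIdeal n J) := by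
  rintro _ ⟨f, hf, rfl⟩
  refine ⟨fun i => ∑ j, f (finProdFinEquiv (i, j)), fun i => ⟨_, fun j => hf _, rfl⟩, ?_⟩
  rw [← finProdFinEquiv.sum_comp, Fintype.sum_prod_type]

theorem sumIdeal_subset_idealSat {P : AddSubmonoid Λ} {I : Set Λ} (hI : IsMonIdeal P I) (n : ℕ) :
    sumIdeal n I ⊆ idealSat P (sumIdeal n I) :=
  fun x hx => ⟨hI.sumIdeal_subset n hx, 1, le_rfl, by simpa using mem_sumIdeal_one hx⟩

theorem sum_sub_nsmul_mem {Q : AddSubmonoid Λ} {J : Set Λ} {a : Λ} (h : ∀ b ∈ J, b - a ∈ Q)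
    {n : ℕ} {x : Λ} (hx : x ∈ sumIdeal n J) : x - n • a ∈ Q := by
  obtain ⟨f, hf, rfl⟩ := hx
  have : ∑ i, f i - n • a = ∑ i, (f i - a) := by simp
  rw [this]
  exact sum_mem fun i _ => h _ (hf i)

/-- The submonoid `P[{b - a : b ∈ J}]` of the ambient group. -/
def adjoinSub (P : AddSubmonoid Λ) (J : Set Λ) (a : Λ) : AddSubmonoid Λ :=
  AddSubmonoid.closure ((P : Set Λ) ∪ {y : Λ | ∃ b ∈ J, y = b - a})

theorem le_adjoinSub (P : AddSubmonoid Λ) (J : Set Λ) (a : Λ) : P ≤ adjoinSub P J a :=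
  fun _ hx => AddSubmonoid.subset_closure (Or.inl hx)

theorem sub_mem_adjoinSub (P : AddSubmonoid Λ) {J : Set Λ} (a : Λ) {b : Λ} (hb : b ∈ J) :
    b - a ∈ adjoinSub P J a :=
  AddSubmonoid.subset_closure (Or.inr ⟨b, hb, rfl⟩)

theorem adjoinSub_le {P Q : AddSubmonoid Λ} {J : Set Λ} {a : Λ} (hP : P ≤ Q)
    (hJ : ∀ b ∈ J, b - a ∈ Q) : adjoinSub P J a ≤ Q := by
  rw [adjoinSub, AddSubmonoid.closure_le]
  rintro x (hx | ⟨b, hb, rfl⟩)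
  exacts [hP hx, hJ b hb]

theorem IsMonIdeal.adjoinSub_fg {P : AddSubmonoid Λ} (hP : P.FG) {I : Set Λ}
    (hI : IsMonIdeal P I) (a : Λ) : (adjoinSub P I a).FG := by
  obtain ⟨F, hF, hFI, hgen⟩ := hI.exists_finite_generators hP
  have : adjoinSub P I a = P ⊔ AddSubmonoid.closure ((· - a) '' F) := by
    refine le_antisymm (adjoinSub_le le_sup_left fun b hb => ?_) (sup_le (le_adjoinSub _ _ _) ?_)
    · obtain ⟨c, hc, p, hp, rfl⟩ := hgen b hb
      rw [add_sub_right_comm, add_comm]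
      exact AddSubmonoid.add_mem_sup hp (AddSubmonoid.subset_closure ⟨c, hc, rfl⟩)
    · rw [AddSubmonoid.closure_le]
      rintro _ ⟨c, hc, rfl⟩
      exact sub_mem_adjoinSub _ _ (hFI hc)
  rw [this]
  exact hP.sup ((AddSubmonoid.fg_iff _).2 ⟨_, rfl, hF.image _⟩)

theorem exists_eq_of_mem_adjoinSub {P : AddSubmonoid Λ} {I : Set Λ} {a x : Λ}
    (hx : x ∈ adjoinSub P I a) :
    ∃ s : ℕ, ∃ p ∈ P, ∃ y ∈ sumIdeal s I, x = p + (y - s • a) := by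
  induction hx using AddSubmonoid.closure_induction with
  | mem x hx =>
    obtain hx | ⟨b, hb, rfl⟩ := hx
    · exact ⟨0, x, hx, 0, ⟨Fin.elim0, fun i => i.elim0, by simp⟩, by simp⟩
    · exact ⟨1, 0, P.zero_mem, b, mem_sumIdeal_one hb, by simp⟩
  | zero => exact ⟨0, 0, P.zero_mem, 0, ⟨Fin.elim0, fun i => i.elim0, by simp⟩, by simp⟩
  | add x y _ _ hx hy =>
    obtain ⟨s, p, hp, u, hu, rfl⟩ := hx
    obtain ⟨t, q, hq, v, hv, rfl⟩ := hy
    exact ⟨s + t, p + q, P.add_mem hp hq, u + v, add_mem_sumIdeal hu hv, by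
      rw [add_smul]; abel⟩

theorem IsMonIdeal.exists_add_nsmul_mem_idealSat {P : AddSubmonoid Λ}
    (hP : ∀ (x : Λ) (n : ℕ), 0 < n → n • x ∈ P → x ∈ P) {I : Set Λ} (hI : IsMonIdeal P I)
    {a : Λ} (ha : a ∈ I) {x : Λ} (hx : ∃ k : ℕ, 1 ≤ k ∧ k • x ∈ adjoinSub P I a) :
    ∃ N : ℕ, ∀ n : ℕ, N ≤ n → 1 ≤ n → x + n • a ∈ idealSat P (sumIdeal n I) := by
  obtain ⟨k, hk, hkx⟩ := hx
  obtain ⟨s, p, hp, y, hy, hxy⟩ := exists_eq_of_mem_adjoinSub hkx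
  refine ⟨s, fun n hsn hn => ?_⟩
  obtain ⟨d, hd⟩ := Nat.exists_eq_add_of_le (hsn.trans (Nat.le_mul_of_pos_left n hk))
  have hmem : k • (x + n • a) ∈ sumIdeal (k * n) I := by
    have : k • (x + n • a) = y + d • a + p := by
      rw [smul_add, smul_smul, hxy, hd, add_smul]; abel
    rw [this]
    refine hI.sumIdeal_add_mem (Nat.mul_pos hk hn) ?_ hp
    rw [hd]
    exact add_mem_sumIdeal hy (nsmul_mem_sumIdeal ha d)
  exact ⟨hP _ k hk (hI.sumIdeal_subset _ hmem), k, hk, sumIdeal_mul_subset _ _ _ hmem⟩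

theorem exists_nsmul_mem_of_mem_adjoinSub_idealSat {P : AddSubmonoid Λ} {I : Set Λ} {a x : Λ}
    {n : ℕ} (hx : x ∈ adjoinSub P (idealSat P (sumIdeal n I)) (n • a)) :
    ∃ k : ℕ, 1 ≤ k ∧ k • x ∈ adjoinSub P I a := by
  induction hx using AddSubmonoid.closure_induction with
  | mem x hx =>
    obtain hx | ⟨c, ⟨-, m, hm, hc⟩, rfl⟩ := hx
    · exact ⟨1, le_rfl, by simpa using le_adjoinSub P I a hx⟩
    · refine ⟨m, hm, ?_⟩
      rw [smul_sub]
      exact sum_sub_nsmul_mem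
        (fun b hb => sum_sub_nsmul_mem (fun b hb => sub_mem_adjoinSub P a hb) hb) hc
  | zero => exact ⟨1, le_rfl, by simp⟩
  | add x y _ _ hx hy =>
    obtain ⟨k, hk, hx⟩ := hx
    obtain ⟨l, hl, hy⟩ := hy
    refine ⟨k * l, Nat.mul_pos hk hl, ?_⟩
    rw [smul_add, mul_comm k l, mul_smul, mul_comm l k, mul_smul]
    exact add_mem (nsmul_mem hx _) (nsmul_mem hy _)

theorem IsToric.addGroup_fg {P : AddSubmonoid Λ} (hP : IsToric P) : AddGroup.FG Λ := by
  obtain ⟨⟨T, rfl⟩, htop, -⟩ := hP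
  exact ⟨T, top_le_iff.1 (htop ▸ (AddSubgroup.closure_le _).2
    (AddSubmonoid.closure_le (S := (AddSubgroup.closure (T : Set Λ)).toAddSubmonoid).2
      AddSubgroup.subset_closure))⟩

theorem IsToric.isAddTorsionFree {P : AddSubmonoid Λ} (hP : IsToric P) : IsAddTorsionFree Λ :=
  ⟨fun n hn x y hxy => sub_eq_zero.1 (hP.2.2.1 _ n (Nat.pos_of_ne_zero hn) (by
    rw [smul_sub, sub_eq_zero]; exact hxy))⟩

/-- key claim in Lemma `satideallem`. Let `P` be a toric monoid (with
`Λ = P^gp`), `I ⊆ P` a nonempty ideal and `a ∈ I`.  Then there is `N ≥ 1` such that for all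
`n ≥ N`, the saturation of the submonoid `P[{b − a : b ∈ I}]` of `P^gp` equals
`P[{c − n·a : c ∈ (nI)^sat}]`. -/
theorem statement11 (P : AddSubmonoid Λ) (hP : IsToric P)
    (I : Set Λ) (hI : IsMonIdeal P I) (hne : I.Nonempty) (a : Λ) (ha : a ∈ I) :
    ∃ N : ℕ, 1 ≤ N ∧ ∀ n : ℕ, N ≤ n →
      {x : Λ | ∃ k : ℕ, 1 ≤ k ∧
          k • x ∈ AddSubmonoid.closure ((P : Set Λ) ∪ {y : Λ | ∃ b ∈ I, y = b - a})} =
      (AddSubmonoid.closure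
          ((P : Set Λ) ∪ {y : Λ | ∃ c ∈ idealSat P (sumIdeal n I), y = c - n • a}) : Set Λ) := by
  have := hP.addGroup_fg
  have := hP.isAddTorsionFree
  obtain ⟨F, hF, hFQ, hgen⟩ := exists_finite_generators_saturation (hI.adjoinSub_fg hP.1 a)
  choose! N hN using fun x hx => hI.exists_add_nsmul_mem_idealSat hP.2.2.2 ha (hFQ x hx)
  obtain ⟨B, hB⟩ := (hF.image N).bddAbove
  refine ⟨B + 1, by omega, fun n hn => Set.Subset.antisymm (fun x hx => ?_)
    fun x hx => exists_nsmul_mem_of_mem_adjoinSub_idealSat hx⟩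
  change x ∈ adjoinSub P (idealSat P (sumIdeal n I)) (n • a)
  obtain ⟨q, hq, y, hy, rfl⟩ := hgen x hx
  refine add_mem (adjoinSub_le (le_adjoinSub _ _ _) (fun b hb => ?_) hq) ?_
  · obtain ⟨m, rfl⟩ := Nat.exists_eq_add_of_le' (show 1 ≤ n by omega)
    have hc := sumIdeal_subset_idealSat hI _
      (add_mem_sumIdeal (nsmul_mem_sumIdeal ha m) (mem_sumIdeal_one hb))
    have : b - a = m • a + b - (m + 1) • a := by rw [add_smul, one_smul]; abel
    rw [this]
    exact sub_mem_adjoinSub _ _ hc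
  · have hc := hN y hy n ((hB ⟨y, hy, rfl⟩).trans (by omega)) (by omega)
    simpa using sub_mem_adjoinSub P (n • a) hc
end
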